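/- arXiv:2507.20918 — 7 statements merged into one kernel-verified Lean document; each statement's English description precedes it below -/
import Mathlib

section
/- For each integer k₀ ≥ 1, the cubic polynomial q(α) = (α − 1) − α²(α + 3)k₀² has exactly one real root α₀, and this root is simple, i.e. q'(α₀) ≠ 0. -/
/-- Every real root of `(x - 1) - x² (x + 3) K` with `K ≥ 1` is less than `-3`. -/
lemma cubic_root_lt_neg_three {K x : ℝ} (hK : 1 ≤ K)
    (hx : (x - 1) - x ^ 2 * (x + 3) * K = 0) : x < -3 := by
  by_contra! h
  have h₀ : 0 ≤ x ^ 2 * (x + 3) := mul_nonneg (sq_nonneg x) (by linarith)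
  have h₁ : x ^ 2 * (x + 3) ≤ x ^ 2 * (x + 3) * K := le_mul_of_one_le_right h₀ hK
  have hx1 : 1 ≤ x := by nlinarith
  nlinarith [mul_nonneg (sq_nonneg x) (by linarith : 0 ≤ x)]

/-- For each integer `k₀ ≥ 1`, the cubic `q(α) = (α − 1) − α²(α + 3)k₀²` has exactly one
real root `α₀`, and this root is simple, i.e. `q'(α₀) ≠ 0`. -/
theorem stmt_0 (k₀ : ℤ) (hk : 1 ≤ k₀) :
    ∃ α₀ : ℝ,
      ((α₀ - 1) - α₀ ^ 2 * (α₀ + 3) * (k₀ : ℝ) ^ 2 = 0) ∧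
      deriv (fun α : ℝ => (α - 1) - α ^ 2 * (α + 3) * (k₀ : ℝ) ^ 2) α₀ ≠ 0 ∧
      ∀ α : ℝ, (α - 1) - α ^ 2 * (α + 3) * (k₀ : ℝ) ^ 2 = 0 → α = α₀ := by
  have hK : (1 : ℝ) ≤ (k₀ : ℝ) ^ 2 := one_le_pow₀ (by exact_mod_cast hk)
  generalize (k₀ : ℝ) ^ 2 = K at hK ⊢
  obtain ⟨a, -, ha⟩ : ∃ a ∈ Set.Icc (-4 : ℝ) (-3), (a - 1) - a ^ 2 * (a + 3) * K = 0 :=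
    intermediate_value_Icc' (f := fun α : ℝ => (α - 1) - α ^ 2 * (α + 3) * K)
      (by norm_num) (by fun_prop) ⟨by norm_num, by norm_num; linarith⟩
  have ha3 := cubic_root_lt_neg_three hK ha
  refine ⟨a, ha, ?_, fun b hb => ?_⟩
  · have hd : HasDerivAt (fun α : ℝ => (α - 1) - α ^ 2 * (α + 3) * K)
        (1 - (2 * a * (a + 3) + a ^ 2 * 1) * K) a := by
      refine ((hasDerivAt_id' a).sub_const 1).fun_sub
        (HasDerivAt.mul_const (HasDerivAt.fun_mul ?_ ((hasDerivAt_id' a).add_const 3)) K)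
      simpa using hasDerivAt_pow 2 a
    rw [hd.deriv]
    have h : 9 < 2 * a * (a + 3) + a ^ 2 * 1 := by nlinarith
    nlinarith
  · have hb3 := cubic_root_lt_neg_three hK hb
    have h : 9 < a ^ 2 + a * b + b ^ 2 + 3 * (a + b) := by nlinarith
    have hprod : (b - a) * (1 - K * (a ^ 2 + a * b + b ^ 2 + 3 * (a + b))) = 0 := by
      linear_combination hb - ha
    rcases mul_eq_zero.mp hprod with h' | h'
    · linarith
    · nlinarith
end

section
/- For each integer k₀ ≥ 1, every real root α₀ of the cubic q(α) = (α − 1) − α²(α + 3)k₀² satisfies α₀ < −3. -/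
/-- For each integer `k₀ ≥ 1`, every real root `α₀` of the cubic
`q(α) = (α − 1) − α²(α + 3)k₀²` satisfies `α₀ < −3`. -/
theorem stmt_2 (k₀ : ℤ) (hk : 1 ≤ k₀) (α₀ : ℝ)
    (hroot : (α₀ - 1) - α₀ ^ 2 * (α₀ + 3) * (k₀ : ℝ) ^ 2 = 0) :
    α₀ < -3 := by
  have hk' : (1 : ℝ) ≤ (k₀ : ℝ) ^ 2 := one_le_pow₀ (by exact_mod_cast hk)
  by_contra! h
  have hs : 0 ≤ α₀ ^ 2 * (α₀ + 3) := mul_nonneg (sq_nonneg _) (by linarith)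
  have hle : α₀ ^ 2 * (α₀ + 3) ≤ α₀ ^ 2 * (α₀ + 3) * (k₀ : ℝ) ^ 2 :=
    le_mul_of_one_le_right hs hk'
  have h1 : 1 ≤ α₀ := by linarith
  have h2 : α₀ + 3 ≤ α₀ ^ 2 * (α₀ + 3) :=
    le_mul_of_one_le_left (by linarith) (one_le_pow₀ h1)
  linarith
end

section
/- Let k₀ ≥ 1 be an integer and let α₀ be a real root of q(α) = (α − 1) − α²(α + 3)k₀². Then for every integer k₁ ≥ 1 with k₁ ≠ k₀, one has (α₀ − 1) − α₀²(α₀ + 3)k₁² ≠ 0. -/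
/-- Let `k₀ ≥ 1` be an integer and let `α₀` be a real root of
`q(α) = (α − 1) − α²(α + 3)k₀²`. Then for every integer `k₁ ≥ 1` with `k₁ ≠ k₀`, one has
`(α₀ − 1) − α₀²(α₀ + 3)k₁² ≠ 0`. -/
theorem stmt_4 (k₀ : ℤ) (hk₀ : 1 ≤ k₀) (α₀ : ℝ)
    (hroot : (α₀ - 1) - α₀ ^ 2 * (α₀ + 3) * (k₀ : ℝ) ^ 2 = 0)
    (k₁ : ℤ) (hk₁ : 1 ≤ k₁) (hne : k₁ ≠ k₀) :
    (α₀ - 1) - α₀ ^ 2 * (α₀ + 3) * (k₁ : ℝ) ^ 2 ≠ 0 := by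
  intro h
  have hsq : (k₀ : ℝ) ^ 2 ≠ (k₁ : ℝ) ^ 2 := by
    norm_cast
    intro hk
    exact hne ((sq_eq_sq₀ (by lia) (by lia)).mp hk).symm
  have hprod : α₀ ^ 2 * (α₀ + 3) * ((k₀ : ℝ) ^ 2 - (k₁ : ℝ) ^ 2) = 0 := by
    linear_combination h - hroot
  have hcoeff : α₀ ^ 2 * (α₀ + 3) = 0 :=
    (mul_eq_zero.mp hprod).resolve_right (sub_ne_zero.mpr hsq)
  have hone : α₀ = 1 := by
    rw [hcoeff] at hroot
    linarith
  norm_num [hone] at hcoeff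
end

section
/- For each integer k₀ ≥ 1, the polynomials q(α) = −k₀²α³ − 3k₀²α² + α − 1 and p(α) = 3k₀²α² + 6k₀²α − 1 have no common root in the complex numbers. -/
/-- For each integer `k₀ ≥ 1`, the polynomials `q(α) = −k₀²α³ − 3k₀²α² + α − 1` and
`p(α) = 3k₀²α² + 6k₀²α − 1` have no common root in the complex numbers. -/
theorem stmt_6 (k₀ : ℤ) (hk : 1 ≤ k₀) (z : ℂ) :
    ¬(-(k₀ : ℂ) ^ 2 * z ^ 3 - 3 * (k₀ : ℂ) ^ 2 * z ^ 2 + z - 1 = 0 ∧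
      3 * (k₀ : ℂ) ^ 2 * z ^ 2 + 6 * (k₀ : ℂ) ^ 2 * z - 1 = 0) := by
  rintro ⟨hq, hp⟩
  have hz : (1 + 3 * (k₀ : ℂ) ^ 2) * z - 2 = 0 := by
    linear_combination (3 / 2) * hq + (z + 1) / 2 * hp
  have hres : 27 * (k₀ : ℂ) ^ 4 + 18 * (k₀ : ℂ) ^ 2 - 1 = 0 := by
    linear_combination (1 + 3 * (k₀ : ℂ) ^ 2) ^ 2 * hp -
      (3 * (k₀ : ℂ) ^ 2 * ((1 + 3 * (k₀ : ℂ) ^ 2) * z + 2) +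
        6 * (k₀ : ℂ) ^ 2 * (1 + 3 * (k₀ : ℂ) ^ 2)) * hz
  have hint : 27 * k₀ ^ 4 + 18 * k₀ ^ 2 - 1 = 0 := by exact_mod_cast hres
  nlinarith [pow_le_pow_left₀ zero_le_one hk 2, pow_le_pow_left₀ zero_le_one hk 4]
end

section
/- Let k₀ ≥ 1 be an integer and let α₀ be a real root of q(α) = (α − 1) − α²(α + 3)k₀². Then −1 + 3k₀²α₀(α₀ + 2) ≠ 0; consequently the transversality coefficient k₀(−1 + 3k₀²α₀(α₀ + 2)) is nonzero. -/
/-- Let `k₀ ≥ 1` be an integer and let `α₀` be a real root of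
`q(α) = (α − 1) − α²(α + 3)k₀²`. Then `−1 + 3k₀²α₀(α₀ + 2) ≠ 0`; consequently the
transversality coefficient `k₀(−1 + 3k₀²α₀(α₀ + 2))` is nonzero. -/
theorem stmt_7 (k₀ : ℤ) (hk : 1 ≤ k₀) (α₀ : ℝ)
    (hroot : (α₀ - 1) - α₀ ^ 2 * (α₀ + 3) * (k₀ : ℝ) ^ 2 = 0) :
    (-1 + 3 * (k₀ : ℝ) ^ 2 * α₀ * (α₀ + 2) ≠ 0) ∧
    ((k₀ : ℝ) * (-1 + 3 * (k₀ : ℝ) ^ 2 * α₀ * (α₀ + 2)) ≠ 0) := by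
  have hk' : (1 : ℝ) ≤ k₀ := by exact_mod_cast hk
  have hne : -1 + 3 * (k₀ : ℝ) ^ 2 * α₀ * (α₀ + 2) ≠ 0 := by
    intro h
    have hsq : α₀ ^ 2 = 3 := by
      linear_combination (3 * (α₀ + 2) / 2) * hroot + (α₀ * (α₀ + 3) / 2) * h
    have hK : (1 : ℝ) ≤ (k₀ : ℝ) ^ 2 := one_le_pow₀ hk'
    have hprod : (k₀ : ℝ) ^ 2 * (9 + 6 * α₀) = 1 := by
      linear_combination h - 3 * (k₀ : ℝ) ^ 2 * hsq
    have hpos : 0 < 9 + 6 * α₀ := by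
      by_contra! hle
      nlinarith
    have hle : 9 + 6 * α₀ ≤ 1 := by nlinarith
    nlinarith
  exact ⟨hne, mul_ne_zero (by positivity) hne⟩
end

section
/- Let k₀ ≥ 1 be an integer and let α₀ be the real root of q(α) = (α − 1) − α²(α + 3)k₀². Suppose v : ℝ → ℝ is smooth, 2π-periodic, and odd, and γ ∈ ℝ is such that (α₀ − 1)v'(σ) + α₀²(α₀ + 3)v'''(σ) − γ = 0 for all σ ∈ ℝ. Then γ = 0 and there exists c ∈ ℝ such that v(σ) = c·sin(k₀σ) for all σ. Conversely, for every c ∈ ℝ, the pair v(σ) = c·sin(k₀σ), γ = 0 satisfies this equation. -/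
open Real

/-- The solution of the harmonic oscillator equation `v'' = -k²v` with `v 0 = 0` is a multiple of
`sin (k * x)`. -/
lemma eq_const_mul_sin_of_oscillator {k : ℝ} (hk : k ≠ 0) {v w : ℝ → ℝ}
    (hv : ∀ x, HasDerivAt v (w x) x) (hw : ∀ x, HasDerivAt w (-(k ^ 2 * v x)) x) (h0 : v 0 = 0)
    (x : ℝ) : v x = w 0 / k * Real.sin (k * x) := by
  have hlin (y : ℝ) : HasDerivAt (fun z : ℝ => k * z) k y := by
    simpa using (hasDerivAt_id y).const_mul k
  let E : ℝ → ℝ := fun y =>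
    (w y - w 0 * Real.cos (k * y)) ^ 2 + (k * v y - w 0 * Real.sin (k * y)) ^ 2
  have hE (y : ℝ) : HasDerivAt E 0 y := by
    refine ((((hw y).sub ((hlin y).cos.const_mul (w 0))).pow 2).add
      ((((hv y).const_mul k).sub ((hlin y).sin.const_mul (w 0))).pow 2)).congr_deriv ?_
    simp only [Pi.sub_apply]
    push_cast
    ring
  have hconst : E x = E 0 :=
    is_const_of_deriv_eq_zero (fun y => (hE y).differentiableAt) (fun y => (hE y).deriv) x 0
  have hsum : (w x - w 0 * Real.cos (k * x)) ^ 2 + (k * v x - w 0 * Real.sin (k * x)) ^ 2 = 0 := by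
    simpa [E, h0] using hconst
  have hsq : (k * v x - w 0 * Real.sin (k * x)) ^ 2 = 0 := by
    nlinarith [sq_nonneg (w x - w 0 * Real.cos (k * x)),
      sq_nonneg (k * v x - w 0 * Real.sin (k * x))]
  have hlinear : k * v x - w 0 * Real.sin (k * x) = 0 := by simpa using hsq
  field_simp
  linarith

/-- A function with constant derivative that takes the same value at `0` and at some `T ≠ 0` is
constant, and its derivative vanishes. -/
lemma eq_zero_and_const_of_hasDerivAt_const {f : ℝ → ℝ} {g T : ℝ} (hT : T ≠ 0)
    (hf : ∀ x, HasDerivAt f g x) (hfT : f T = f 0) : g = 0 ∧ ∀ x, f x = f 0 := by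
  have haff (x : ℝ) : f x - g * x = f 0 := by
    have hd (y : ℝ) : HasDerivAt (fun z => f z - g * z) 0 y := by
      exact ((hf y).sub ((hasDerivAt_id y).const_mul g)).congr_deriv (by ring)
    simpa using is_const_of_deriv_eq_zero (fun y => (hd y).differentiableAt)
      (fun y => (hd y).deriv) x 0
  have hg : g = 0 := by
    have h := haff T
    have : g * T = 0 := by linarith
    exact (mul_eq_zero.mp this).resolve_right hT
  exact ⟨hg, fun x => by simpa [hg] using haff x⟩

lemma deriv_const_mul_sin (c k : ℝ) :
    deriv (fun x : ℝ => c * Real.sin (k * x)) = fun x => c * k * Real.cos (k * x) := by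
  ext x
  have hlin : HasDerivAt (fun z : ℝ => k * z) k x := by
    simpa using (hasDerivAt_id x).const_mul k
  rw [(hlin.sin.const_mul c).deriv]
  ring

lemma deriv_const_mul_cos (c k : ℝ) :
    deriv (fun x : ℝ => c * Real.cos (k * x)) = fun x => -(c * k) * Real.sin (k * x) := by
  ext x
  have hlin : HasDerivAt (fun z : ℝ => k * z) k x := by
    simpa using (hasDerivAt_id x).const_mul k
  rw [(hlin.cos.const_mul c).deriv]
  ring

/-- Let `k₀ ≥ 1` be an integer and let `α₀` be the real root of
`q(α) = (α − 1) − α²(α + 3)k₀²`. Suppose `v : ℝ → ℝ` is smooth, 2π-periodic, and odd,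
and `γ ∈ ℝ` is such that `(α₀ − 1)v′(σ) + α₀²(α₀ + 3)v‴(σ) − γ = 0` for all `σ`. Then
`γ = 0` and `v(σ) = c·sin(k₀σ)` for some `c`. Conversely, every such pair `(c·sin(k₀σ), 0)`
satisfies the equation. -/
theorem stmt_8 (k₀ : ℤ) (hk : 1 ≤ k₀) (α₀ : ℝ)
    (hroot : (α₀ - 1) - α₀ ^ 2 * (α₀ + 3) * (k₀ : ℝ) ^ 2 = 0) :
    (∀ v : ℝ → ℝ, ∀ γ : ℝ, ContDiff ℝ (⊤ : ℕ∞) v →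
      (∀ σ : ℝ, v (σ + 2 * π) = v σ) →
      (∀ σ : ℝ, v (-σ) = -v σ) →
      (∀ σ : ℝ, (α₀ - 1) * deriv v σ + α₀ ^ 2 * (α₀ + 3) * deriv^[3] v σ - γ = 0) →
      γ = 0 ∧ ∃ c : ℝ, ∀ σ : ℝ, v σ = c * Real.sin ((k₀ : ℝ) * σ)) ∧
    (∀ c : ℝ, ∀ σ : ℝ,
      (α₀ - 1) * deriv (fun σ : ℝ => c * Real.sin ((k₀ : ℝ) * σ)) σ +
        α₀ ^ 2 * (α₀ + 3) * deriv^[3] (fun σ : ℝ => c * Real.sin ((k₀ : ℝ) * σ)) σ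
        - (0 : ℝ) = 0) := by
  have hk0 : (k₀ : ℝ) ≠ 0 := by
    have : k₀ ≠ 0 := by omega
    exact_mod_cast this
  have hb : α₀ ^ 2 * (α₀ + 3) ≠ 0 := by
    intro hb
    have hα : α₀ = 1 := by
      rw [hb] at hroot
      linarith
    norm_num [hα] at hb
  have ha : α₀ - 1 = α₀ ^ 2 * (α₀ + 3) * (k₀ : ℝ) ^ 2 := by linarith
  refine ⟨fun v γ hv hper hodd heq => ?_, fun c σ => ?_⟩
  · have hv1 : ContDiff ℝ (⊤ : ℕ∞) (deriv v) := hv.iterate_deriv 1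
    have hv2 : ContDiff ℝ (⊤ : ℕ∞) (deriv (deriv v)) := hv.iterate_deriv 2
    have hd0 (x : ℝ) : HasDerivAt v (deriv v x) x :=
      (hv.differentiable (by simp) x).hasDerivAt
    have hd1 (x : ℝ) : HasDerivAt (deriv v) (deriv (deriv v) x) x :=
      (hv1.differentiable (by simp) x).hasDerivAt
    have hd2 (x : ℝ) : HasDerivAt (deriv (deriv v)) (deriv^[3] v x) x :=
      (hv2.differentiable (by simp) x).hasDerivAt
    have hper1 (x : ℝ) : deriv v (x + 2 * π) = deriv v x := by
      rw [← deriv_comp_add_const, funext hper]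
    have hper2 (x : ℝ) : deriv (deriv v) (x + 2 * π) = deriv (deriv v) x := by
      rw [← deriv_comp_add_const, funext hper1]
    have heven1 (x : ℝ) : deriv v (-x) = deriv v x := by
      have h := deriv_comp_neg v x
      rw [funext hodd, deriv.fun_neg] at h
      linarith
    have hodd2 (x : ℝ) : deriv (deriv v) (-x) = -deriv (deriv v) x := by
      have h := deriv_comp_neg (deriv v) x
      rw [funext heven1] at h
      linarith
    have hv0 : v 0 = 0 := by
      have h := hodd 0
      rw [neg_zero] at h
      linarith
    have hv20 : deriv (deriv v) 0 = 0 := by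
      have h := hodd2 0
      rw [neg_zero] at h
      linarith
    have hW (x : ℝ) : HasDerivAt (fun y => deriv (deriv v) y + (k₀ : ℝ) ^ 2 * v y)
        (γ / (α₀ ^ 2 * (α₀ + 3))) x := by
      refine ((hd2 x).add ((hd0 x).const_mul ((k₀ : ℝ) ^ 2))).congr_deriv ?_
      rw [eq_div_iff hb]
      have h := heq x
      rw [ha] at h
      linarith
    obtain ⟨hγ, hconst⟩ := eq_zero_and_const_of_hasDerivAt_const Real.two_pi_pos.ne' hW (by
      have h := hper 0
      have h2 := hper2 0
      rw [zero_add] at h h2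
      simp only [h, h2])
    refine ⟨(div_eq_zero_iff.mp hγ).resolve_right hb, deriv v 0 / k₀,
      eq_const_mul_sin_of_oscillator hk0 hd0 (fun x => ?_) hv0⟩
    have h := hconst x
    simp only [hv0, hv20, mul_zero, add_zero] at h
    rw [← eq_neg_of_add_eq_zero_left h]
    exact hd1 x
  · simp only [Function.iterate_succ, Function.iterate_zero, Function.comp_apply, id_eq,
      deriv_const_mul_sin, deriv_const_mul_cos]
    rw [ha]
    ring
end

section
/- Let k₀ ≥ 1 be an integer and set α₁ = 4k₀² + 1. Suppose v : ℝ → ℝ is smooth, 2π-periodic, and odd, and γ ∈ ℝ is such that (α₁ − 1)v'(σ) + 4v'''(σ) − γ = 0 for all σ ∈ ℝ. Then γ = 0 and there exists c ∈ ℝ such that v(σ) = c·sin(k₀σ) for all σ. Conversely, for every c ∈ ℝ, the pair v(σ) = c·sin(k₀σ), γ = 0 satisfies this equation. -/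
open Real

/-- The first derivative of a periodic function is periodic. -/
theorem Function.Periodic.deriv_periodic {f : ℝ → ℝ} {T : ℝ} (hf : Function.Periodic f T) :
    Function.Periodic (deriv f) T := by
  intro x
  rw [← deriv_comp_add_const, hf.funext]

/-- A solution of the harmonic oscillator equation vanishing at the origin is a sine. -/
theorem eq_mul_sin_of_harmonic {f f' : ℝ → ℝ} {k : ℝ} (hk : k ≠ 0)
    (hf : ∀ x, HasDerivAt f (f' x) x) (hf' : ∀ x, HasDerivAt f' (-(k ^ 2 * f x)) x)
    (h0 : f 0 = 0) (x : ℝ) : f x = f' 0 / k * Real.sin (k * x) := by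
  have hlin (y : ℝ) : HasDerivAt (fun y => k * y) k y := by
    simpa using (hasDerivAt_id y).const_mul k
  have hF (y : ℝ) : HasDerivAt
      (fun y => f' y * Real.cos (k * y) + k * f y * Real.sin (k * y)) 0 y := by
    refine (((hf' y).fun_mul (hlin y).cos).fun_add
      (((hf y).const_mul k).fun_mul (hlin y).sin)).congr_deriv ?_
    ring
  have hG (y : ℝ) : HasDerivAt
      (fun y => f' y * Real.sin (k * y) - k * f y * Real.cos (k * y)) 0 y := by
    refine (((hf' y).fun_mul (hlin y).sin).fun_sub
      (((hf y).const_mul k).fun_mul (hlin y).cos)).congr_deriv ?_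
    ring
  have eF := is_const_of_deriv_eq_zero (fun y => (hF y).differentiableAt)
    (fun y => (hF y).deriv) x 0
  have eG := is_const_of_deriv_eq_zero (fun y => (hG y).differentiableAt)
    (fun y => (hG y).deriv) x 0
  simp only [mul_zero, Real.cos_zero, Real.sin_zero, h0, mul_one, add_zero, sub_zero] at eF eG
  field_simp
  linear_combination Real.sin (k * x) * eF - Real.cos (k * x) * eG -
    k * f x * Real.sin_sq_add_cos_sq (k * x)

/-- The first three derivatives of a multiple of `sin (k x)`. -/
theorem deriv_const_mul_sin_and_third (c k : ℝ) :
    deriv (fun x : ℝ => c * Real.sin (k * x)) = (fun x => c * k * Real.cos (k * x)) ∧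
      deriv^[3] (fun x : ℝ => c * Real.sin (k * x)) =
        fun x => -(c * k ^ 3 * Real.cos (k * x)) := by
  have hlin (y : ℝ) : HasDerivAt (fun y => k * y) k y := by
    simpa using (hasDerivAt_id y).const_mul k
  have hsin (a : ℝ) : deriv (fun x : ℝ => a * Real.sin (k * x)) =
      fun x => a * k * Real.cos (k * x) := by
    funext x
    rw [((hlin x).sin.const_mul a).deriv]
    ring
  have hcos (a : ℝ) : deriv (fun x : ℝ => a * Real.cos (k * x)) =
      fun x => -(a * k) * Real.sin (k * x) := by
    funext x
    rw [((hlin x).cos.const_mul a).deriv]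
    ring
  refine ⟨hsin c, ?_⟩
  simp only [Function.iterate_succ, Function.iterate_zero, Function.comp_apply, id_eq]
  rw [hsin, hcos, hsin]
  funext x
  ring

/-- Let `k₀ ≥ 1` be an integer and set `α₁ = 4k₀² + 1`. Suppose `v : ℝ → ℝ` is smooth,
2π-periodic, and odd, and `γ ∈ ℝ` is such that `(α₁ − 1)v′(σ) + 4v‴(σ) − γ = 0` for all
`σ`. Then `γ = 0` and `v(σ) = c·sin(k₀σ)` for some `c`. Conversely, every such pair
`(c·sin(k₀σ), 0)` satisfies the equation. -/
theorem stmt_9 (k₀ : ℤ) (hk : 1 ≤ k₀) (α₁ : ℝ) (hα₁ : α₁ = 4 * (k₀ : ℝ) ^ 2 + 1) :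
    (∀ v : ℝ → ℝ, ∀ γ : ℝ, ContDiff ℝ (⊤ : ℕ∞) v →
      (∀ σ : ℝ, v (σ + 2 * π) = v σ) →
      (∀ σ : ℝ, v (-σ) = -v σ) →
      (∀ σ : ℝ, (α₁ - 1) * deriv v σ + 4 * deriv^[3] v σ - γ = 0) →
      γ = 0 ∧ ∃ c : ℝ, ∀ σ : ℝ, v σ = c * Real.sin ((k₀ : ℝ) * σ)) ∧
    (∀ c : ℝ, ∀ σ : ℝ,
      (α₁ - 1) * deriv (fun σ : ℝ => c * Real.sin ((k₀ : ℝ) * σ)) σ +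
        4 * deriv^[3] (fun σ : ℝ => c * Real.sin ((k₀ : ℝ) * σ)) σ - (0 : ℝ) = 0) := by
  have hk0 : (k₀ : ℝ) ≠ 0 := by
    exact_mod_cast (by lia : k₀ ≠ 0)
  subst hα₁
  refine ⟨fun v γ hv hper hodd heq => ?_, fun c σ => ?_⟩
  · simp only [Function.iterate_succ, Function.iterate_zero, Function.comp_apply, id_eq] at heq
    have hv1 : ContDiff ℝ (⊤ : ℕ∞) (deriv v) := (contDiff_infty_iff_deriv.1 hv).2
    have hv2 : ContDiff ℝ (⊤ : ℕ∞) (deriv (deriv v)) := (contDiff_infty_iff_deriv.1 hv1).2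
    have d0 (x : ℝ) : HasDerivAt v (deriv v x) x :=
      ((contDiff_infty_iff_deriv.1 hv).1 x).hasDerivAt
    have d1 (x : ℝ) : HasDerivAt (deriv v) (deriv (deriv v) x) x :=
      ((contDiff_infty_iff_deriv.1 hv1).1 x).hasDerivAt
    have d2 (x : ℝ) : HasDerivAt (deriv (deriv v)) (deriv (deriv (deriv v)) x) x :=
      ((contDiff_infty_iff_deriv.1 hv2).1 x).hasDerivAt
    have hp : Function.Periodic v (2 * π) := hper
    have hv0 : v 0 = 0 := by
      have := hodd 0
      rw [neg_zero] at this
      linarith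
    have hodd2 : deriv (deriv v) 0 = 0 := by
      have e1 (x : ℝ) : deriv v (-x) = deriv v x := by
        have h := deriv_comp_neg v x
        rw [funext hodd, deriv.fun_neg] at h
        linarith
      have h := deriv_comp_neg (deriv v) 0
      rw [funext e1, neg_zero] at h
      linarith
    have hI (x : ℝ) : HasDerivAt
        (fun x => (k₀ : ℝ) ^ 2 * v x + deriv (deriv v) x - γ / 4 * x) 0 x := by
      refine ((((d0 x).const_mul ((k₀ : ℝ) ^ 2)).fun_add (d2 x)).fun_sub
        ((hasDerivAt_id x).const_mul (γ / 4))).congr_deriv ?_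
      linear_combination heq x / 4
    have hfirst (x : ℝ) : (k₀ : ℝ) ^ 2 * v x + deriv (deriv v) x - γ / 4 * x = 0 := by
      have h := is_const_of_deriv_eq_zero (fun y => (hI y).differentiableAt)
        (fun y => (hI y).deriv) x 0
      simpa [hv0, hodd2] using h
    have hγ : γ = 0 := by
      have h := hfirst (0 + 2 * π)
      rw [hp 0, hp.deriv_periodic.deriv_periodic 0, hv0, hodd2] at h
      have hπ := Real.pi_ne_zero
      have h' : γ * π = 0 := by linarith
      exact (mul_eq_zero.1 h').resolve_right hπ
    subst hγ
    refine ⟨rfl, deriv v 0 / k₀, eq_mul_sin_of_harmonic hk0 d0 (fun x => ?_) hv0⟩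
    refine (d1 x).congr_deriv ?_
    linear_combination hfirst x
  · obtain ⟨h1, h3⟩ := deriv_const_mul_sin_and_third c k₀
    rw [h1, h3]
    ring
end
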